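/- arXiv:math/0701352 — 2 statements merged into one kernel-verified Lean document; each statement's English description precedes it below -/
import Mathlib

section
/- Let A be a positive semidefinite matrix whose rows and columns are indexed by a triple product I×J×K of finite index sets (an operator on ℂ^I ⊗ ℂ^J ⊗ ℂ^K), and let 0 < p ≤ 1. Let Tr_1 A be the partial trace over the I factor (a matrix indexed by J×K), and let Tr_J denote partial trace over the J factor. Then Tr((Tr_J((Tr_1 A)^p))^{1/p}) ≥ Tr((Tr_J(A^p))^{1/p}), where the outer traces are the ordinary traces on ℂ^K and on ℂ^I ⊗ ℂ^K respectively. -/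
open Matrix
open scoped ComplexOrder

/-- Matrix power via the functional calculus: for a Hermitian matrix, apply the real
power `x ^ s` to the eigenvalues in its spectral decomposition (so `0 ^ s = 0` for `s > 0`);
junk value `0` for non-Hermitian matrices. -/
noncomputable def matrixRpow {n : Type*} [Fintype n] [DecidableEq n]
    (A : Matrix n n ℂ) (s : ℝ) : Matrix n n ℂ :=
  if h : A.IsHermitian then
    (h.eigenvectorUnitary : Matrix n n ℂ) *
      Matrix.diagonal (fun i => ((h.eigenvalues i ^ s : ℝ) : ℂ)) *
        (star h.eigenvectorUnitary : Matrix n n ℂ)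
  else 0

/-- Partial trace over the first factor: `(Tr₁ A)(j,j') = ∑ i, A((i,j),(i,j'))`. -/
noncomputable def ptraceFst {I J : Type*} [Fintype I]
    (A : Matrix (I × J) (I × J) ℂ) : Matrix J J ℂ :=
  Matrix.of fun j j' => ∑ i, A (i, j) (i, j')

/-- Partial trace over the middle factor of a triple product:
`(Tr_J A)((i,k),(i',k')) = ∑ j, A((i,j,k),(i',j,k'))`. -/
noncomputable def ptraceMid {I J K : Type*} [Fintype J]
    (A : Matrix (I × J × K) (I × J × K) ℂ) : Matrix (I × K) (I × K) ℂ :=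
  Matrix.of fun p q => ∑ j, A (p.1, j, p.2) (q.1, j, q.2)

open scoped Kronecker

/-- The matrix `U * diag(a) * Uᴴ` with real diagonal `a`. -/
noncomputable def unitaryDiag {n : Type*} [Fintype n] [DecidableEq n]
    (U : Matrix n n ℂ) (a : n → ℝ) : Matrix n n ℂ :=
  U * diagonal (fun i => (a i : ℂ)) * Uᴴ

section UnitaryDiag

variable {n : Type*} [Fintype n] [DecidableEq n]

lemma Matrix.IsHermitian.eq_unitaryDiag {A : Matrix n n ℂ} (h : A.IsHermitian) :
    unitaryDiag (h.eigenvectorUnitary : Matrix n n ℂ) h.eigenvalues = A := by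
  conv_rhs => rw [h.spectral_theorem]
  rfl

lemma matrixRpow_eq_unitaryDiag {A : Matrix n n ℂ} (h : A.IsHermitian) (s : ℝ) :
    matrixRpow A s =
      unitaryDiag (h.eigenvectorUnitary : Matrix n n ℂ) (fun i => h.eigenvalues i ^ s) := by
  simp only [matrixRpow, dif_pos h]
  rfl

lemma Matrix.IsHermitian.eigenvectorUnitary_mul_conjTranspose {A : Matrix n n ℂ}
    (h : A.IsHermitian) :
    (h.eigenvectorUnitary : Matrix n n ℂ) * (h.eigenvectorUnitary : Matrix n n ℂ)ᴴ = 1 :=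
  Unitary.coe_mul_star_self h.eigenvectorUnitary

lemma posSemidef_unitaryDiag (U : Matrix n n ℂ) {a : n → ℝ} (ha : ∀ i, 0 ≤ a i) :
    (unitaryDiag U a).PosSemidef :=
  (PosSemidef.diagonal (fun i => Complex.zero_le_real.2 (ha i))).mul_mul_conjTranspose_same U

lemma Matrix.PosSemidef.matrixRpow {A : Matrix n n ℂ} (h : A.PosSemidef) (s : ℝ) :
    (_root_.matrixRpow A s).PosSemidef := by
  rw [matrixRpow_eq_unitaryDiag h.1]
  exact posSemidef_unitaryDiag _ fun i => Real.rpow_nonneg (h.eigenvalues_nonneg i) s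

lemma trace_unitaryDiag {U : Matrix n n ℂ} (hU : U * Uᴴ = 1) (a : n → ℝ) :
    (unitaryDiag U a).trace.re = ∑ i, a i := by
  rw [unitaryDiag, trace_mul_comm, ← mul_assoc, mul_eq_one_comm.mp hU, one_mul, trace_diagonal]
  simp

lemma unitaryDiag_mul_unitaryDiag {U : Matrix n n ℂ} (hU : U * Uᴴ = 1) (a b : n → ℝ) :
    unitaryDiag U a * unitaryDiag U b = unitaryDiag U (fun i => a i * b i) := by
  have h : diagonal (fun i => ((a i * b i : ℝ) : ℂ)) =
      diagonal (fun i => (a i : ℂ)) * (Uᴴ * U) * diagonal (fun i => (b i : ℂ)) := by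
    rw [mul_eq_one_comm.mp hU, mul_one, diagonal_mul_diagonal]
    simp
  simp only [unitaryDiag, h, mul_assoc]

/-- `Tr (A X Xᴴ)` as a weighted sum of squared entries, for `A = U diag(a) Uᴴ`. -/
lemma trace_unitaryDiag_mul_mul_conjTranspose {m : Type*} [Fintype m]
    (U : Matrix n n ℂ) (a : n → ℝ) (X : Matrix n m ℂ) :
    (unitaryDiag U a * (X * Xᴴ)).trace.re = ∑ i, ∑ j, a i * ‖(Uᴴ * X) i j‖ ^ 2 := by
  have h : (unitaryDiag U a * (X * Xᴴ)).trace =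
      (diagonal (fun i => (a i : ℂ)) * ((Uᴴ * X) * (Uᴴ * X)ᴴ)).trace := by
    rw [unitaryDiag, conjTranspose_mul, conjTranspose_conjTranspose, mul_assoc, mul_assoc,
      trace_mul_comm]
    simp only [Matrix.mul_assoc]
  rw [h, trace, Complex.re_sum]
  refine Finset.sum_congr rfl fun i _ => ?_
  rw [diag_apply, diagonal_mul, mul_apply, Complex.re_ofReal_mul, Complex.re_sum, Finset.mul_sum]
  refine Finset.sum_congr rfl fun j _ => ?_
  rw [conjTranspose_apply, RCLike.star_def, Complex.mul_conj, Complex.ofReal_re,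
    Complex.normSq_eq_norm_sq]

lemma trace_unitaryDiag_mul_unitaryDiag (U V : Matrix n n ℂ) (a b : n → ℝ) :
    (unitaryDiag U a * unitaryDiag V b).trace.re =
      ∑ i, ∑ j, ‖(Uᴴ * V) i j‖ ^ 2 * (a i * b j) := by
  have h : (unitaryDiag U a * unitaryDiag V b).trace =
      (diagonal (fun i => (a i : ℂ)) *
        ((Uᴴ * V) * diagonal (fun i => (b i : ℂ)) * (Uᴴ * V)ᴴ)).trace := by
    rw [unitaryDiag, unitaryDiag, conjTranspose_mul, conjTranspose_conjTranspose, mul_assoc,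
      mul_assoc, trace_mul_comm]
    simp only [mul_assoc]
  rw [h, trace, Complex.re_sum]
  refine Finset.sum_congr rfl fun i _ => ?_
  rw [diag_apply, diagonal_mul, mul_apply, Complex.re_ofReal_mul, Complex.re_sum, Finset.mul_sum]
  refine Finset.sum_congr rfl fun j _ => ?_
  rw [conjTranspose_apply, mul_diagonal, RCLike.star_def, mul_right_comm, Complex.mul_conj,
    ← Complex.ofReal_mul, Complex.ofReal_re, Complex.normSq_eq_norm_sq]
  ring

lemma sum_norm_sq_row_eq_one {W : Matrix n n ℂ} (hW : W * Wᴴ = 1) (i : n) :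
    ∑ j, ‖W i j‖ ^ 2 = 1 := by
  have h := congrArg Complex.re (congrFun (congrFun hW i) i)
  rw [mul_apply, Complex.re_sum, one_apply_eq, Complex.one_re] at h
  rw [← h]
  refine Finset.sum_congr rfl fun j _ => ?_
  rw [conjTranspose_apply, RCLike.star_def, Complex.mul_conj, Complex.ofReal_re,
    Complex.normSq_eq_norm_sq]

lemma sum_norm_sq_col_eq_one {W : Matrix n n ℂ} (hW : W * Wᴴ = 1) (j : n) :
    ∑ i, ‖W i j‖ ^ 2 = 1 := by
  have h : Wᴴ * Wᴴᴴ = 1 := by rw [conjTranspose_conjTranspose, mul_eq_one_comm.mp hW]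
  simpa using sum_norm_sq_row_eq_one h j

lemma conjTranspose_mul_mul_conjTranspose_eq_one {U V : Matrix n n ℂ} (hU : U * Uᴴ = 1)
    (hV : V * Vᴴ = 1) : (Uᴴ * V) * (Uᴴ * V)ᴴ = 1 := by
  rw [conjTranspose_mul, conjTranspose_conjTranspose, mul_assoc, ← mul_assoc V, hV, one_mul,
    mul_eq_one_comm.mp hU]

/-- Young's inequality under the trace. -/
lemma trace_unitaryDiag_mul_rpow_le {U V : Matrix n n ℂ} (hU : U * Uᴴ = 1) (hV : V * Vᴴ = 1)
    {x z : n → ℝ} (hx : ∀ i, 0 ≤ x i) (hz : ∀ i, 0 ≤ z i) {p : ℝ} (hp0 : 0 < p) (hp1 : p ≤ 1) :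
    (unitaryDiag U x * unitaryDiag V (fun i => z i ^ (1 - p))).trace.re ≤
      p * ∑ i, x i ^ (1 / p) + (1 - p) * ∑ i, z i := by
  have hW := conjTranspose_mul_mul_conjTranspose_eq_one hU hV
  rw [trace_unitaryDiag_mul_unitaryDiag]
  calc _ ≤ ∑ i, ∑ j, ‖(Uᴴ * V) i j‖ ^ 2 * (p * x i ^ (1 / p) + (1 - p) * z j) := by
        gcongr with i _ j _
        have h := Real.geom_mean_le_arith_mean2_weighted hp0.le (sub_nonneg.2 hp1)
          (Real.rpow_nonneg (hx i) (1 / p)) (hz j) (by ring)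
        rwa [← Real.rpow_mul (hx i), one_div_mul_cancel hp0.ne', Real.rpow_one] at h
    _ = ∑ i, (∑ j, ‖(Uᴴ * V) i j‖ ^ 2) * (p * x i ^ (1 / p)) +
          ∑ j, (∑ i, ‖(Uᴴ * V) i j‖ ^ 2) * ((1 - p) * z j) := by
        simp only [mul_add, Finset.sum_add_distrib, Finset.sum_mul]
        congr 1
        exact Finset.sum_comm
    _ = _ := by
        simp only [sum_norm_sq_row_eq_one hW, sum_norm_sq_col_eq_one hW, one_mul, Finset.mul_sum]

end UnitaryDiag

section ParallelSum

lemma mul_div_add_mul_norm_sq_le {a b : ℝ} (ha : 0 ≤ a) (hb : 0 ≤ b) (m y : ℂ) :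
    ‖m‖ ^ 2 * (a * b / (a + b)) ≤ a * ‖y‖ ^ 2 + b * ‖m - y‖ ^ 2 := by
  rcases (add_nonneg ha hb).eq_or_lt with h | h
  · rw [← h, div_zero, mul_zero]
    positivity
  have hm : ‖m‖ ≤ ‖y‖ + ‖m - y‖ := by simpa using norm_add_le y (m - y)
  have hm2 : ‖m‖ ^ 2 ≤ (‖y‖ + ‖m - y‖) ^ 2 := by gcongr
  rw [← mul_div_assoc, div_le_iff₀ h]
  nlinarith [mul_le_mul_of_nonneg_right hm2 (mul_nonneg ha hb), sq_nonneg (a * ‖y‖ - b * ‖m - y‖)]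

lemma mul_div_add_mul_norm_sq_eq {a b : ℝ} (ha : 0 ≤ a) (hb : 0 ≤ b) (m : ℂ) :
    ‖m‖ ^ 2 * (a * b / (a + b)) =
      a * ‖((b / (a + b) : ℝ) : ℂ) * m‖ ^ 2 + b * ‖m - ((b / (a + b) : ℝ) : ℂ) * m‖ ^ 2 := by
  have hsub : m - ((b / (a + b) : ℝ) : ℂ) * m = ((1 - b / (a + b) : ℝ) : ℂ) * m := by
    push_cast; ring
  rw [hsub, norm_mul, norm_mul, Complex.norm_real, Complex.norm_real, mul_pow, mul_pow,
    Real.norm_eq_abs, Real.norm_eq_abs, sq_abs, sq_abs]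
  rcases (add_nonneg ha hb).eq_or_lt with h | h
  · have ha0 : a = 0 := by linarith
    have hb0 : b = 0 := by linarith
    simp [ha0, hb0]
  · field_simp
    ring

variable {n : Type*} [Fintype n] [DecidableEq n]

lemma trace_mul_add_trace_mul_eq_sum {U V : Matrix n n ℂ} (hU : U * Uᴴ = 1) (hV : V * Vᴴ = 1)
    (a b : n → ℝ) (X : Matrix n n ℂ) :
    (unitaryDiag U a * (X * Xᴴ)).trace.re + (unitaryDiag V b * ((1 - X)ᴴ * (1 - X))).trace.re =
      ∑ i, ∑ j, (a i * ‖(Uᴴ * X * V) i j‖ ^ 2 +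
        b j * ‖(Uᴴ * V) i j - (Uᴴ * X * V) i j‖ ^ 2) := by
  have h1 : X * Xᴴ = (X * V) * (X * V)ᴴ := by
    rw [conjTranspose_mul, mul_assoc, ← mul_assoc V, hV, one_mul]
  have h2 : (1 - X)ᴴ * (1 - X) = ((1 - X)ᴴ * U) * ((1 - X)ᴴ * U)ᴴ := by
    rw [conjTranspose_mul, conjTranspose_conjTranspose, mul_assoc, ← mul_assoc U, hU, one_mul]
  rw [h1, h2, trace_unitaryDiag_mul_mul_conjTranspose, trace_unitaryDiag_mul_mul_conjTranspose,
    Finset.sum_comm (γ := n) (f := fun i j => b i * _), ← Finset.sum_add_distrib]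
  refine Finset.sum_congr rfl fun i _ => ?_
  rw [← Finset.sum_add_distrib]
  refine Finset.sum_congr rfl fun j _ => ?_
  have h3 : Vᴴ * ((1 - X)ᴴ * U) = (Uᴴ * V - Uᴴ * X * V)ᴴ := by
    simp only [conjTranspose_sub, conjTranspose_mul, conjTranspose_conjTranspose,
      conjTranspose_one, mul_sub, sub_mul, one_mul, mul_assoc]
  rw [h3, conjTranspose_apply, norm_star, Matrix.sub_apply, mul_assoc Uᴴ X V]

lemma sum_parallelSum_le {U V : Matrix n n ℂ} (hU : U * Uᴴ = 1) (hV : V * Vᴴ = 1)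
    {a b : n → ℝ} (ha : ∀ i, 0 ≤ a i) (hb : ∀ i, 0 ≤ b i) (X : Matrix n n ℂ) :
    ∑ i, ∑ j, ‖(Uᴴ * V) i j‖ ^ 2 * (a i * b j / (a i + b j)) ≤
      (unitaryDiag U a * (X * Xᴴ)).trace.re +
        (unitaryDiag V b * ((1 - X)ᴴ * (1 - X))).trace.re := by
  rw [trace_mul_add_trace_mul_eq_sum hU hV]
  gcongr with i _ j _
  exact mul_div_add_mul_norm_sq_le (ha i) (hb j) _ _

lemma exists_sum_parallelSum_eq {U V : Matrix n n ℂ} (hU : U * Uᴴ = 1) (hV : V * Vᴴ = 1)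
    {a b : n → ℝ} (ha : ∀ i, 0 ≤ a i) (hb : ∀ i, 0 ≤ b i) :
    ∃ X : Matrix n n ℂ,
      ∑ i, ∑ j, ‖(Uᴴ * V) i j‖ ^ 2 * (a i * b j / (a i + b j)) =
        (unitaryDiag U a * (X * Xᴴ)).trace.re +
          (unitaryDiag V b * ((1 - X)ᴴ * (1 - X))).trace.re := by
  let Y : Matrix n n ℂ :=
    Matrix.of fun i j => ((b j / (a i + b j) : ℝ) : ℂ) * (Uᴴ * V) i j
  refine ⟨U * Y * Vᴴ, ?_⟩
  have hY : Uᴴ * (U * Y * Vᴴ) * V = Y := by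
    rw [← mul_assoc, ← mul_assoc, mul_eq_one_comm.mp hU, one_mul, mul_assoc,
      mul_eq_one_comm.mp hV, mul_one]
  rw [trace_mul_add_trace_mul_eq_sum hU hV, hY]
  refine Finset.sum_congr rfl fun i _ => Finset.sum_congr rfl fun j _ => ?_
  exact mul_div_add_mul_norm_sq_eq (ha i) (hb j) _

end ParallelSum

section PartialTrace

variable {I J : Type*} [Fintype I]

lemma Matrix.PosSemidef.ptraceFst {A : Matrix (I × J) (I × J) ℂ} (hA : A.PosSemidef) :
    (_root_.ptraceFst A).PosSemidef := by
  have h : _root_.ptraceFst A = ∑ i, A.submatrix (fun j => (i, j)) (fun j => (i, j)) := by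
    ext j j'
    simp [_root_.ptraceFst, Matrix.sum_apply]
  rw [h]
  exact posSemidef_sum _ fun i _ => hA.submatrix _

variable [Fintype J]

lemma trace_ptraceFst (A : Matrix (I × J) (I × J) ℂ) : (ptraceFst A).trace = A.trace := by
  simp only [trace, diag_apply, ptraceFst, of_apply, Fintype.sum_prod_type]
  exact Finset.sum_comm

lemma trace_mul_one_kronecker [DecidableEq I] (A : Matrix (I × J) (I × J) ℂ) (Z : Matrix J J ℂ) :
    (A * ((1 : Matrix I I ℂ) ⊗ₖ Z)).trace = (ptraceFst A * Z).trace := by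
  simp only [trace, diag_apply, mul_apply, ptraceFst, of_apply, Fintype.sum_prod_type,
    kroneckerMap_apply, one_apply, ite_mul, one_mul, zero_mul, mul_ite, mul_zero,
    Finset.sum_mul]
  rw [Finset.sum_comm]
  refine Finset.sum_congr rfl fun j _ => ?_
  rw [Finset.sum_comm (s := Finset.univ (α := J))]
  refine Finset.sum_congr rfl fun i _ => ?_
  rw [Finset.sum_comm]
  simp

lemma one_kronecker_unitaryDiag [DecidableEq I] [DecidableEq J] (U : Matrix J J ℂ) (a : J → ℝ) :
    (1 : Matrix I I ℂ) ⊗ₖ unitaryDiag U a =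
      unitaryDiag ((1 : Matrix I I ℂ) ⊗ₖ U) (fun i => a i.2) := by
  have h : diagonal (fun i : I × J => (a i.2 : ℂ)) =
      (1 : Matrix I I ℂ) ⊗ₖ diagonal (fun j => (a j : ℂ)) := by
    rw [← diagonal_one, diagonal_kronecker_diagonal]
    simp
  rw [unitaryDiag, unitaryDiag, h, conjTranspose_kronecker, ← mul_kronecker_mul,
    ← mul_kronecker_mul]
  simp

lemma one_kronecker_mul_conjTranspose [DecidableEq I] [DecidableEq J] {U : Matrix J J ℂ}
    (hU : U * Uᴴ = 1) : ((1 : Matrix I I ℂ) ⊗ₖ U) * ((1 : Matrix I I ℂ) ⊗ₖ U)ᴴ = 1 := by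
  rw [conjTranspose_kronecker, ← mul_kronecker_mul, hU]
  simp

/-- The parallel sum form of the overlap is monotone under partial traces: it is an infimum, and
for the partial traces the infimum runs over the subset of matrices `1 ⊗ X`. -/
lemma sum_parallelSum_le_ptraceFst [DecidableEq I] [DecidableEq J]
    {U V : Matrix (I × J) (I × J) ℂ} {U' V' : Matrix J J ℂ}
    (hU : U * Uᴴ = 1) (hV : V * Vᴴ = 1) (hU' : U' * U'ᴴ = 1) (hV' : V' * V'ᴴ = 1)
    {a b : I × J → ℝ} {a' b' : J → ℝ} (ha : ∀ i, 0 ≤ a i) (hb : ∀ i, 0 ≤ b i)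
    (ha' : ∀ i, 0 ≤ a' i) (hb' : ∀ i, 0 ≤ b' i)
    (hA : ptraceFst (unitaryDiag U a) = unitaryDiag U' a')
    (hB : ptraceFst (unitaryDiag V b) = unitaryDiag V' b') :
    ∑ i, ∑ j, ‖(Uᴴ * V) i j‖ ^ 2 * (a i * b j / (a i + b j)) ≤
      ∑ i, ∑ j, ‖(U'ᴴ * V') i j‖ ^ 2 * (a' i * b' j / (a' i + b' j)) := by
  obtain ⟨X, hX⟩ := exists_sum_parallelSum_eq hU' hV' ha' hb'
  rw [hX, ← hA, ← hB, ← trace_mul_one_kronecker, ← trace_mul_one_kronecker]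
  refine (sum_parallelSum_le hU hV ha hb ((1 : Matrix I I ℂ) ⊗ₖ X)).trans_eq ?_
  have h : (1 : Matrix (I × J) (I × J) ℂ) - (1 : Matrix I I ℂ) ⊗ₖ X =
      (1 : Matrix I I ℂ) ⊗ₖ (1 - X) := by
    rw [← one_kronecker_one]
    ext x y
    simp only [Matrix.sub_apply, kroneckerMap_apply, mul_sub]
  rw [h, conjTranspose_kronecker, conjTranspose_kronecker, ← mul_kronecker_mul,
    ← mul_kronecker_mul]
  simp

end PartialTrace

section Lieb

open MeasureTheory Set

lemma unitaryDiag_smul {n : Type*} [Fintype n] [DecidableEq n] (U : Matrix n n ℂ) (t : ℝ)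
    (a : n → ℝ) : unitaryDiag U (fun i => t * a i) = (t : ℂ) • unitaryDiag U a := by
  have h : diagonal (fun i => ((t * a i : ℝ) : ℂ)) =
      (t : ℂ) • diagonal (fun i => (a i : ℂ)) := by
    ext i j
    simp [diagonal_apply]
  rw [unitaryDiag, unitaryDiag, h]
  simp

lemma ptraceFst_smul {I J : Type*} [Fintype I] (c : ℂ) (A : Matrix (I × J) (I × J) ℂ) :
    ptraceFst (c • A) = c • ptraceFst A := by
  ext j j'
  simp [ptraceFst, Finset.mul_sum]

/-- The integrand that represents `a ^ p * b ^ (1 - p)`, up to a constant, as a mixture of parallel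
sums. -/
lemma mul_rpowIntegrand₀₁_div {p t a b : ℝ} (hp : p ∈ Ioo 0 1) (ht : 0 < t) (ha : 0 ≤ a)
    (hb : 0 ≤ b) :
    b * Real.rpowIntegrand₀₁ p t (a / b) = t ^ (p - 2) * (a * (t * b) / (a + t * b)) := by
  rw [Real.rpowIntegrand₀₁_eq_pow_div hp ht.le (div_nonneg ha hb)]
  rcases hb.eq_or_lt with rfl | hb
  · simp
  have h : t ^ (p - 1) = t ^ (p - 2) * t := by
    rw [← Real.rpow_add_one ht.ne']
    congr 1
    ring
  have h1 : t + a / b ≠ 0 := by positivity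
  have h2 : a + t * b ≠ 0 := by positivity
  rw [h]
  field_simp
  ring

lemma mul_rpow_div_eq {p a b : ℝ} (hp : p < 1) (ha : 0 ≤ a) (hb : 0 ≤ b) :
    a ^ p * b ^ (1 - p) = b * (a / b) ^ p := by
  rcases hb.eq_or_lt with rfl | hb
  · rw [Real.zero_rpow (by linarith), mul_zero, zero_mul]
  · rw [Real.div_rpow ha hb.le, Real.rpow_sub hb, Real.rpow_one]
    ring

lemma sum_mul_rpow_eq_integral {n : Type*} [Fintype n] {p : ℝ} (hp : p ∈ Ioo 0 1)
    (w : n → n → ℝ) {a b : n → ℝ} (ha : ∀ i, 0 ≤ a i) (hb : ∀ i, 0 ≤ b i) :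
    IntegrableOn (fun t => t ^ (p - 2) *
      ∑ i, ∑ j, w i j * (a i * (t * b j) / (a i + t * b j))) (Ioi 0) ∧
    (∑ i, ∑ j, w i j * (a i ^ p * b j ^ (1 - p))) *
        (∫ t in Ioi 0, Real.rpowIntegrand₀₁ p t 1) =
      ∫ t in Ioi 0, t ^ (p - 2) * ∑ i, ∑ j, w i j * (a i * (t * b j) / (a i + t * b j)) := by
  have hEq : EqOn (fun t => ∑ i, ∑ j, w i j * (b j * Real.rpowIntegrand₀₁ p t (a i / b j)))
      (fun t => t ^ (p - 2) * ∑ i, ∑ j, w i j * (a i * (t * b j) / (a i + t * b j)))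
      (Ioi 0) := by
    intro t ht
    simp only [Finset.mul_sum, mul_rpowIntegrand₀₁_div hp ht (ha _) (hb _), mul_left_comm]
  have hInt (i j : n) : IntegrableOn
      (fun t => w i j * (b j * Real.rpowIntegrand₀₁ p t (a i / b j))) (Ioi 0) :=
    ((Real.integrableOn_rpowIntegrand₀₁_Ioi hp (div_nonneg (ha i) (hb j))).const_mul _).const_mul _
  refine ⟨IntegrableOn.congr_fun (integrable_finsetSum _ fun i _ =>
    integrable_finsetSum _ fun j _ => hInt i j) hEq measurableSet_Ioi, ?_⟩
  rw [← setIntegral_congr_fun measurableSet_Ioi hEq, integral_finsetSum _ fun i _ =>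
    integrable_finsetSum _ fun j _ => hInt i j, Finset.sum_mul]
  refine Finset.sum_congr rfl fun i _ => ?_
  rw [integral_finsetSum _ fun j _ => hInt i j, Finset.sum_mul]
  refine Finset.sum_congr rfl fun j _ => ?_
  rw [integral_const_mul, integral_const_mul,
    Real.integral_rpowIntegrand₀₁_eq_rpow_mul_const hp (div_nonneg (ha i) (hb j)),
    mul_rpow_div_eq hp.2 (ha i) (hb j)]
  ring

/-- `Tr (A ^ p * B ^ (1 - p))` does not decrease when `A` and `B` are replaced by their partial
traces. -/
lemma trace_rpow_mul_rpow_le_ptraceFst {I J : Type*} [Fintype I] [Fintype J]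
    [DecidableEq I] [DecidableEq J]
    {U V : Matrix (I × J) (I × J) ℂ} {U' V' : Matrix J J ℂ}
    (hU : U * Uᴴ = 1) (hV : V * Vᴴ = 1) (hU' : U' * U'ᴴ = 1) (hV' : V' * V'ᴴ = 1)
    {a b : I × J → ℝ} {a' b' : J → ℝ} (ha : ∀ i, 0 ≤ a i) (hb : ∀ i, 0 ≤ b i)
    (ha' : ∀ i, 0 ≤ a' i) (hb' : ∀ i, 0 ≤ b' i)
    (hA : ptraceFst (unitaryDiag U a) = unitaryDiag U' a')
    (hB : ptraceFst (unitaryDiag V b) = unitaryDiag V' b')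
    {p : ℝ} (hp0 : 0 < p) (hp1 : p ≤ 1) :
    (unitaryDiag U (fun i => a i ^ p) * unitaryDiag V (fun i => b i ^ (1 - p))).trace.re ≤
      (unitaryDiag U' (fun i => a' i ^ p) *
        unitaryDiag V' (fun i => b' i ^ (1 - p))).trace.re := by
  rcases hp1.eq_or_lt with rfl | hp1
  · have h1 : unitaryDiag V (fun _ => (1 : ℝ)) = 1 := by simp [unitaryDiag, hV]
    have h2 : unitaryDiag V' (fun _ => (1 : ℝ)) = 1 := by simp [unitaryDiag, hV']
    simp only [Real.rpow_one, sub_self, Real.rpow_zero, h1, h2, mul_one, ← hA, trace_ptraceFst,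
      le_refl]
  have hp : p ∈ Ioo 0 1 := ⟨hp0, hp1⟩
  rw [trace_unitaryDiag_mul_unitaryDiag, trace_unitaryDiag_mul_unitaryDiag]
  refine le_of_mul_le_mul_right ?_ (Real.integral_rpowIntegrand₀₁_one_pos hp)
  obtain ⟨hi, he⟩ := sum_mul_rpow_eq_integral hp (fun i j => ‖(Uᴴ * V) i j‖ ^ 2) ha hb
  obtain ⟨hi', he'⟩ := sum_mul_rpow_eq_integral hp (fun i j => ‖(U'ᴴ * V') i j‖ ^ 2) ha' hb'
  rw [he, he']
  refine setIntegral_mono_on hi hi' measurableSet_Ioi fun t ht => ?_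
  have ht : 0 < t := ht
  refine mul_le_mul_of_nonneg_left ?_ (Real.rpow_nonneg ht.le _)
  refine sum_parallelSum_le_ptraceFst hU hV hU' hV' ha (fun i => mul_nonneg ht.le (hb i)) ha'
    (fun i => mul_nonneg ht.le (hb' i)) hA ?_
  rw [unitaryDiag_smul, unitaryDiag_smul, ptraceFst_smul, hB]

end Lieb

section MiddleFactor

variable {I J K : Type*}

/-- Moves the middle factor of a triple product to the front. -/
def midToFront (I J K : Type*) : I × J × K ≃ J × I × K where
  toFun x := (x.2.1, x.1, x.2.2)
  invFun x := (x.2.1, x.1, x.2.2)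
  left_inv _ := rfl
  right_inv _ := rfl

/-- The matrix acting as `M` on the outer factors and as the identity on the middle factor. -/
noncomputable def ampliateMid (J : Type*) [DecidableEq J] (M : Matrix (I × K) (I × K) ℂ) :
    Matrix (I × J × K) (I × J × K) ℂ :=
  ((1 : Matrix J J ℂ) ⊗ₖ M).submatrix (midToFront I J K) (midToFront I J K)

lemma ptraceMid_eq_ptraceFst [Fintype J] (A : Matrix (I × J × K) (I × J × K) ℂ) :
    ptraceMid A =
      ptraceFst (A.submatrix (midToFront I J K).symm (midToFront I J K).symm) := rfl

lemma Matrix.PosSemidef.ptraceMid [Fintype J] {A : Matrix (I × J × K) (I × J × K) ℂ}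
    (hA : A.PosSemidef) : (_root_.ptraceMid A).PosSemidef := by
  rw [ptraceMid_eq_ptraceFst]
  exact (hA.submatrix _).ptraceFst

lemma ptraceFst_ampliateMid [Fintype I] [DecidableEq J] (M : Matrix (I × K) (I × K) ℂ) :
    ptraceFst (ampliateMid J M) = (1 : Matrix J J ℂ) ⊗ₖ ptraceFst M := by
  ext x y
  simp [ptraceFst, ampliateMid, midToFront, Finset.mul_sum]

variable [Fintype I] [Fintype J] [Fintype K] [DecidableEq J]

lemma trace_submatrix_equiv_symm {m n : Type*} [Fintype m] [Fintype n] (e : m ≃ n)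
    (A : Matrix m m ℂ) : (A.submatrix e.symm e.symm).trace = A.trace :=
  Equiv.sum_comp e.symm (fun i => A i i)

lemma trace_mul_ampliateMid (A : Matrix (I × J × K) (I × J × K) ℂ)
    (Z : Matrix (I × K) (I × K) ℂ) :
    (A * ampliateMid J Z).trace = (ptraceMid A * Z).trace := by
  rw [ptraceMid_eq_ptraceFst, ← trace_mul_one_kronecker,
    ← trace_submatrix_equiv_symm (midToFront I J K) (A * ampliateMid J Z),
    ← submatrix_mul_equiv _ _ _ (midToFront I J K).symm]
  simp [ampliateMid]

variable [DecidableEq I] [DecidableEq K]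

lemma ampliateMid_unitaryDiag (U : Matrix (I × K) (I × K) ℂ) (a : I × K → ℝ) :
    ampliateMid J (unitaryDiag U a) =
      unitaryDiag (ampliateMid J U) (fun x => a (x.1, x.2.2)) := by
  have h : diagonal (fun x : I × J × K => (a (x.1, x.2.2) : ℂ)) =
      (diagonal (fun x : J × I × K => (a x.2 : ℂ))).submatrix
        (midToFront I J K) (midToFront I J K) := by
    rw [submatrix_diagonal_equiv]
    rfl
  rw [ampliateMid, one_kronecker_unitaryDiag, unitaryDiag, unitaryDiag, h, ampliateMid,
    conjTranspose_submatrix, submatrix_mul_equiv, submatrix_mul_equiv]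

lemma ampliateMid_mul_conjTranspose {U : Matrix (I × K) (I × K) ℂ} (hU : U * Uᴴ = 1) :
    ampliateMid J U * (ampliateMid J U)ᴴ = 1 := by
  rw [ampliateMid, conjTranspose_submatrix, submatrix_mul_equiv,
    one_kronecker_mul_conjTranspose hU, submatrix_one_equiv]

end MiddleFactor

/-- **Tracial Minkowski inequality for three spaces, `0 < p ≤ 1` (reversed):**
for a positive semidefinite `A` on `ℂ^I ⊗ ℂ^J ⊗ ℂ^K`,
`Tr ((Tr_J ((Tr₁ A)^p))^{1/p}) ≥ Tr ((Tr_J (A^p))^{1/p})`.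
Here the inner `ptraceFst` is the partial trace over `I` and the outer partial traces
are over `J`. -/
theorem trace_minkowski_three_factors_le_one {I J K : Type*}
    [Fintype I] [Fintype J] [Fintype K] [DecidableEq I] [DecidableEq J] [DecidableEq K]
    (A : Matrix (I × J × K) (I × J × K) ℂ) (hA : A.PosSemidef)
    (p : ℝ) (hp0 : 0 < p) (hp1 : p ≤ 1) :
    (matrixRpow (ptraceMid (matrixRpow A p)) (1 / p)).trace.re
      ≤ (matrixRpow (ptraceFst (matrixRpow (ptraceFst A) p)) (1 / p)).trace.re := by
  have hX := (hA.matrixRpow p).ptraceMid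
  have hX' := (hA.ptraceFst.matrixRpow p).ptraceFst
  have hU := hX.1.eigenvectorUnitary_mul_conjTranspose
  set U : Matrix (I × K) (I × K) ℂ := (hX.1.eigenvectorUnitary : Matrix (I × K) (I × K) ℂ)
  set x := hX.1.eigenvalues with hxdef
  have hx : ∀ i, 0 ≤ x i := hX.eigenvalues_nonneg
  have hz : ∀ i, 0 ≤ x i ^ (1 / p) := fun i => Real.rpow_nonneg (hx i) _
  have hZ : (ptraceFst (unitaryDiag U fun i => x i ^ (1 / p))).PosSemidef :=
    (posSemidef_unitaryDiag U hz).ptraceFst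
  have hUZ := hZ.1.eigenvectorUnitary_mul_conjTranspose
  have hT : (matrixRpow (ptraceMid (matrixRpow A p)) (1 / p)).trace.re =
      ∑ i, x i ^ (1 / p) := by
    rw [matrixRpow_eq_unitaryDiag hX.1, trace_unitaryDiag hU]
  have hTZ : ∑ i, hZ.1.eigenvalues i = ∑ i, x i ^ (1 / p) := by
    rw [← trace_unitaryDiag hUZ, hZ.1.eq_unitaryDiag, trace_ptraceFst, trace_unitaryDiag hU]
  have hT' : (matrixRpow (ptraceFst (matrixRpow (ptraceFst A) p)) (1 / p)).trace.re =
      ∑ i, hX'.1.eigenvalues i ^ (1 / p) := by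
    rw [matrixRpow_eq_unitaryDiag hX'.1,
      trace_unitaryDiag hX'.1.eigenvectorUnitary_mul_conjTranspose]
  have hLieb := trace_rpow_mul_rpow_le_ptraceFst
    hA.1.eigenvectorUnitary_mul_conjTranspose (ampliateMid_mul_conjTranspose (J := J) hU)
    hA.ptraceFst.1.eigenvectorUnitary_mul_conjTranspose
    (one_kronecker_mul_conjTranspose (I := J) hUZ)
    hA.eigenvalues_nonneg (fun i => hz (i.1, i.2.2)) hA.ptraceFst.eigenvalues_nonneg
    (fun i => hZ.eigenvalues_nonneg i.2)
    (by rw [hA.1.eq_unitaryDiag, hA.ptraceFst.1.eq_unitaryDiag])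
    (by rw [← ampliateMid_unitaryDiag U (fun i => x i ^ (1 / p)), ptraceFst_ampliateMid,
          ← one_kronecker_unitaryDiag, hZ.1.eq_unitaryDiag]) hp0 hp1
  rw [← matrixRpow_eq_unitaryDiag, ← matrixRpow_eq_unitaryDiag,
    ← ampliateMid_unitaryDiag U (fun i => (x i ^ (1 / p)) ^ (1 - p)),
    ← one_kronecker_unitaryDiag (I := J) _ (fun i => hZ.1.eigenvalues i ^ (1 - p)),
    trace_mul_ampliateMid, trace_mul_one_kronecker] at hLieb
  have hleft : (ptraceMid (matrixRpow A p) *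
      unitaryDiag U (fun i => (x i ^ (1 / p)) ^ (1 - p))).trace.re = ∑ i, x i ^ (1 / p) := by
    nth_rw 1 [← hX.1.eq_unitaryDiag]
    rw [unitaryDiag_mul_unitaryDiag hU, trace_unitaryDiag hU]
    refine Finset.sum_congr rfl fun i _ => ?_
    rcases (hx i).eq_or_lt with h | h
    · rw [← hxdef, ← h, zero_mul, Real.zero_rpow (one_div_pos.2 hp0).ne']
    · rw [← hxdef, ← Real.rpow_mul h.le, ← Real.rpow_one_add' h.le]
      · congr 1
        field_simp
        ring
      · have : 0 ≤ 1 / p * (1 - p) := mul_nonneg (by positivity) (by linarith)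
        linarith
  have hYoung := trace_unitaryDiag_mul_rpow_le hX'.1.eigenvectorUnitary_mul_conjTranspose hUZ
    hX'.eigenvalues_nonneg hZ.eigenvalues_nonneg hp0 hp1
  rw [hX'.1.eq_unitaryDiag, hTZ] at hYoung
  rw [hleft] at hLieb
  rw [hT, hT']
  have := hLieb.trans hYoung
  exact le_of_mul_le_mul_left (by linarith) hp0
end

section
/- For p = 2, the map Ψ_2(A) = Tr((Tr_2 A^2)^{1/2}) is convex on positive semidefinite matrices indexed by I×J: for positive semidefinite A, B indexed by I×J and t ∈ [0,1], Ψ_2(t·A + (1−t)·B) ≤ t·Ψ_2(A) + (1−t)·Ψ_2(B). -/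
open Matrix
open scoped ComplexOrder

/-- Partial trace over the second factor: `(Tr₂ A)(i,i') = ∑ j, A((i,j),(i',j))`. -/
noncomputable def ptraceSnd {I J : Type*} [Fintype J]
    (A : Matrix (I × J) (I × J) ℂ) : Matrix I I ℂ :=
  Matrix.of fun i i' => ∑ j, A (i, j) (i', j)

/-- `Ψ_p(A) = Tr((Tr₂ A^p)^{1/p})`. -/
noncomputable def Psi {I J : Type*} [Fintype I] [Fintype J] [DecidableEq I] [DecidableEq J]
    (p : ℝ) (A : Matrix (I × J) (I × J) ℂ) : ℝ :=
  (matrixRpow (ptraceSnd (matrixRpow A p)) (1 / p)).trace.re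

/-- The trace of a matrix power of a Hermitian matrix is the sum of the powers of its
eigenvalues. -/
theorem trace_matrixRpow {n : Type*} [Fintype n] [DecidableEq n] {A : Matrix n n ℂ}
    (h : A.IsHermitian) (s : ℝ) :
    (matrixRpow A s).trace.re = ∑ i, h.eigenvalues i ^ s := by
  rw [matrixRpow, dif_pos h, Matrix.trace_mul_comm, ← Matrix.mul_assoc,
    Unitary.coe_star_mul_self, Matrix.one_mul, Matrix.trace_diagonal, Complex.re_sum]
  simp only [Complex.ofReal_re]

/-- The spectral theorem with the eigenvalue matrix written explicitly. -/
theorem Matrix.IsHermitian.star_eigenvectorUnitary_mul_mul {n : Type*} [Fintype n] [DecidableEq n]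
    {A : Matrix n n ℂ} (h : A.IsHermitian) :
    (star h.eigenvectorUnitary : Matrix n n ℂ) * A * (h.eigenvectorUnitary : Matrix n n ℂ) =
      Matrix.diagonal (fun i => (h.eigenvalues i : ℂ)) := by
  have := h.conjStarAlgAut_star_eigenvectorUnitary
  rw [Unitary.conjStarAlgAut_star_apply] at this
  exact this

theorem Matrix.IsHermitian.eq_eigenvectorUnitary_mul_diagonal_mul {n : Type*} [Fintype n]
    [DecidableEq n] {A : Matrix n n ℂ} (h : A.IsHermitian) :
    A = (h.eigenvectorUnitary : Matrix n n ℂ) *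
      Matrix.diagonal (fun i => (h.eigenvalues i : ℂ)) *
        (star h.eigenvectorUnitary : Matrix n n ℂ) := by
  have := h.spectral_theorem
  rw [Unitary.conjStarAlgAut_apply] at this
  exact this

theorem matrixRpow_two {n : Type*} [Fintype n] [DecidableEq n] {A : Matrix n n ℂ}
    (h : A.IsHermitian) : matrixRpow A 2 = A * Aᴴ := by
  rw [h.eq, matrixRpow, dif_pos h]
  conv_rhs => rw [h.eq_eigenvectorUnitary_mul_diagonal_mul]
  set U : Matrix n n ℂ := (h.eigenvectorUnitary : Matrix n n ℂ)
  have hU : star U * U = 1 := Unitary.coe_star_mul_self _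
  have hd : Matrix.diagonal (fun i => ((h.eigenvalues i ^ (2 : ℝ) : ℝ) : ℂ)) =
      Matrix.diagonal (fun i => (h.eigenvalues i : ℂ)) *
        Matrix.diagonal (fun i => (h.eigenvalues i : ℂ)) := by
    rw [Matrix.diagonal_mul_diagonal]
    congr 1
    funext i
    rw [Real.rpow_two, sq, Complex.ofReal_mul]
  rw [hd]
  calc _ = U * Matrix.diagonal (fun i => (h.eigenvalues i : ℂ)) * 1 *
        Matrix.diagonal (fun i => (h.eigenvalues i : ℂ)) * star U := by
          simp only [Matrix.mul_one, Matrix.mul_assoc]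
    _ = _ := by rw [← hU]; simp only [Matrix.mul_assoc]

/-- The trace norm `Tr (X X*)^{1/2}` of a rectangular matrix. -/
noncomputable def matrixTraceNorm {n m : Type*} [Fintype n] [Fintype m] [DecidableEq n]
    (X : Matrix n m ℂ) : ℝ :=
  (matrixRpow (X * Xᴴ) (1 / 2)).trace.re

theorem matrixTraceNorm_eq_sum_sqrt {n m : Type*} [Fintype n] [Fintype m] [DecidableEq n]
    (X : Matrix n m ℂ) :
    matrixTraceNorm X =
      ∑ i, Real.sqrt ((isHermitian_mul_conjTranspose_self X).eigenvalues i) := by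
  simp only [matrixTraceNorm, trace_matrixRpow (isHermitian_mul_conjTranspose_self X),
    Real.sqrt_eq_rpow]

/-- The trace norm is attained as a trace pairing with a contraction. -/
theorem exists_contraction_trace_eq_matrixTraceNorm {n m : Type*} [Fintype n] [Fintype m]
    [DecidableEq n] (X : Matrix n m ℂ) :
    ∃ W : Matrix m n ℂ, (1 - Wᴴ * W).PosSemidef ∧ (X * W).trace.re = matrixTraceNorm X := by
  have h := isHermitian_mul_conjTranspose_self X
  have hsp := h.star_eigenvectorUnitary_mul_mul
  have hnn : ∀ i, 0 ≤ h.eigenvalues i := (posSemidef_self_mul_conjTranspose X).eigenvalues_nonneg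
  rw [matrixTraceNorm_eq_sum_sqrt]
  set U : Matrix n n ℂ := (h.eigenvectorUnitary : Matrix n n ℂ)
  have hU : star U * U = 1 := Unitary.coe_star_mul_self _
  have hU' : U * star U = 1 := Unitary.coe_mul_star_self _
  set D : Matrix n n ℂ :=
    Matrix.diagonal (fun i => (((Real.sqrt (h.eigenvalues i))⁻¹ : ℝ) : ℂ)) with hD
  have hDH : Dᴴ = D := by
    rw [hD, Matrix.diagonal_conjTranspose]
    congr 1
    funext i
    simp
  refine ⟨Xᴴ * U * D * star U, ?_, ?_⟩
  · have hW : (Xᴴ * U * D * star U)ᴴ * (Xᴴ * U * D * star U) =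
        U * (D * (star U * (X * Xᴴ) * U) * D) * star U := by
      simp only [Matrix.conjTranspose_mul, Matrix.conjTranspose_conjTranspose, hDH,
        Matrix.star_eq_conjTranspose, Matrix.mul_assoc]
    have hsub : 1 - (Xᴴ * U * D * star U)ᴴ * (Xᴴ * U * D * star U) =
        U * (1 - D * (star U * (X * Xᴴ) * U) * D) * Uᴴ := by
      rw [hW, Matrix.mul_sub, Matrix.sub_mul, Matrix.mul_one, ← Matrix.star_eq_conjTranspose, hU']
    rw [hsub]
    refine Matrix.PosSemidef.mul_mul_conjTranspose_same ?_ U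
    rw [hsp, hD, Matrix.diagonal_mul_diagonal, Matrix.diagonal_mul_diagonal,
      ← Matrix.diagonal_one, Matrix.diagonal_sub]
    refine Matrix.PosSemidef.diagonal fun i => ?_
    have : (0 : ℝ) ≤ 1 - (Real.sqrt (h.eigenvalues i))⁻¹ * h.eigenvalues i *
        (Real.sqrt (h.eigenvalues i))⁻¹ := by
      rcases (hnn i).eq_or_lt with h0 | h0
      · simp [← h0]
      · have hs := Real.sqrt_pos.2 h0
        have : (Real.sqrt (h.eigenvalues i))⁻¹ * h.eigenvalues i *
            (Real.sqrt (h.eigenvalues i))⁻¹ = 1 := by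
          field_simp
          rw [Real.sq_sqrt h0.le]
        rw [this, sub_self]
    simpa using Complex.zero_le_real.2 this
  · have htr : (X * (Xᴴ * U * D * star U)).trace = (star U * (X * Xᴴ) * U * D).trace := by
      rw [← Matrix.mul_assoc, Matrix.trace_mul_comm]
      simp only [Matrix.mul_assoc]
    rw [htr, hsp, hD, Matrix.diagonal_mul_diagonal, Matrix.trace_diagonal, Complex.re_sum]
    refine Finset.sum_congr rfl fun i _ => ?_
    rw [← Complex.ofReal_mul, Complex.ofReal_re, ← div_eq_mul_inv, Real.div_sqrt]

/-- The diagonal of `Y Y*` consists of the squared row norms of `Y`. -/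
theorem mul_conjTranspose_apply_self_re {n m : Type*} [Fintype m] (Y : Matrix n m ℂ) (i : n) :
    ((Y * Yᴴ) i i).re = ∑ k, ‖Y i k‖ ^ 2 := by
  rw [Matrix.mul_apply, Complex.re_sum]
  refine Finset.sum_congr rfl fun k _ => ?_
  rw [Matrix.conjTranspose_apply, Complex.star_def, Complex.mul_conj, Complex.ofReal_re,
    Complex.normSq_eq_norm_sq]

/-- Pairing with a contraction is bounded by the trace norm. -/
theorem trace_mul_re_le_matrixTraceNorm {n m : Type*} [Fintype n] [Fintype m] [DecidableEq n]
    (X : Matrix n m ℂ) {W : Matrix m n ℂ} (hW : (1 - Wᴴ * W).PosSemidef) :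
    (X * W).trace.re ≤ matrixTraceNorm X := by
  have h := isHermitian_mul_conjTranspose_self X
  have hsp := h.star_eigenvectorUnitary_mul_mul
  rw [matrixTraceNorm_eq_sum_sqrt]
  set U : Matrix n n ℂ := (h.eigenvectorUnitary : Matrix n n ℂ)
  have hU : star U * U = 1 := Unitary.coe_star_mul_self _
  have hU' : U * star U = 1 := Unitary.coe_mul_star_self _
  have htr : (X * W).trace = ((star U * X) * (W * U)).trace := by
    rw [Matrix.mul_assoc, Matrix.trace_mul_comm (star U), Matrix.mul_assoc, Matrix.mul_assoc,
      hU', Matrix.mul_one]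
  rw [htr, Matrix.trace, Complex.re_sum]
  refine Finset.sum_le_sum fun i _ => ?_
  have hrow : ∑ k, ‖(star U * X) i k‖ ^ 2 = h.eigenvalues i := by
    have hY : (star U * X) * (star U * X)ᴴ = star U * (X * Xᴴ) * U := by
      simp only [Matrix.conjTranspose_mul, Matrix.conjTranspose_conjTranspose,
        Matrix.star_eq_conjTranspose, Matrix.mul_assoc]
    rw [← mul_conjTranspose_apply_self_re, hY, hsp, Matrix.diagonal_apply_eq, Complex.ofReal_re]
  have hcol : ∑ k, ‖(W * U) k i‖ ^ 2 ≤ 1 := by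
    have hP := hW.conjTranspose_mul_mul_same U
    have hY : Uᴴ * (1 - Wᴴ * W) * U = 1 - (W * U)ᴴ * (W * U)ᴴᴴ := by
      rw [Matrix.mul_sub, Matrix.sub_mul, Matrix.mul_one, ← Matrix.star_eq_conjTranspose U, hU]
      simp only [Matrix.conjTranspose_mul, Matrix.conjTranspose_conjTranspose,
        Matrix.star_eq_conjTranspose, Matrix.mul_assoc]
    rw [hY] at hP
    have hd := (Complex.le_def.1 (hP.diag_nonneg (i := i))).1
    rw [Matrix.sub_apply, Matrix.one_apply_eq, Complex.sub_re,
      mul_conjTranspose_apply_self_re] at hd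
    simpa using hd
  calc (((star U * X) * (W * U)).diag i).re
      ≤ ‖((star U * X) * (W * U)) i i‖ := Complex.re_le_norm _
    _ ≤ ∑ k, ‖(star U * X) i k‖ * ‖(W * U) k i‖ := by
        rw [Matrix.mul_apply]
        exact (norm_sum_le _ _).trans_eq (Finset.sum_congr rfl fun k _ => norm_mul _ _)
    _ ≤ Real.sqrt (∑ k, ‖(star U * X) i k‖ ^ 2) * Real.sqrt (∑ k, ‖(W * U) k i‖ ^ 2) :=
        Real.sum_mul_le_sqrt_mul_sqrt _ _ _
    _ ≤ Real.sqrt (h.eigenvalues i) * 1 := by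
        rw [hrow]
        exact mul_le_mul_of_nonneg_left (Real.sqrt_le_one.2 hcol) (Real.sqrt_nonneg _)
    _ = _ := mul_one _

theorem matrixTraceNorm_convex {n m : Type*} [Fintype n] [Fintype m] [DecidableEq n]
    (X Y : Matrix n m ℂ) {a b : ℝ} (ha : 0 ≤ a) (hb : 0 ≤ b) :
    matrixTraceNorm (a • X + b • Y) ≤ a * matrixTraceNorm X + b * matrixTraceNorm Y := by
  obtain ⟨W, hW, hWe⟩ := exists_contraction_trace_eq_matrixTraceNorm (a • X + b • Y)
  rw [← hWe, Matrix.add_mul, Matrix.smul_mul, Matrix.smul_mul, Matrix.trace_add,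
    Matrix.trace_smul, Matrix.trace_smul, Complex.add_re, Complex.smul_re, Complex.smul_re,
    smul_eq_mul, smul_eq_mul]
  exact add_le_add
    (mul_le_mul_of_nonneg_left (trace_mul_re_le_matrixTraceNorm X hW) ha)
    (mul_le_mul_of_nonneg_left (trace_mul_re_le_matrixTraceNorm Y hW) hb)

/-- Move the second row index of a matrix to its columns. -/
def rowReshape {I J K : Type*} (A : Matrix (I × J) K ℂ) : Matrix I (J × K) ℂ :=
  Matrix.of fun i q => A (i, q.1) q.2

theorem ptraceSnd_mul_conjTranspose_self {I J K : Type*} [Fintype J] [Fintype K]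
    (A : Matrix (I × J) K ℂ) :
    ptraceSnd (A * Aᴴ) = rowReshape A * (rowReshape A)ᴴ := by
  ext i i'
  simp [ptraceSnd, rowReshape, Matrix.mul_apply, Fintype.sum_prod_type]

theorem Psi_two_eq_matrixTraceNorm {I J : Type*} [Fintype I] [Fintype J] [DecidableEq I]
    [DecidableEq J] {A : Matrix (I × J) (I × J) ℂ} (hA : A.IsHermitian) :
    Psi 2 A = matrixTraceNorm (rowReshape A) := by
  rw [Psi, matrixRpow_two hA, ptraceSnd_mul_conjTranspose_self, matrixTraceNorm]

/-- **Convexity of `Ψ_2`:** the map `A ↦ Tr((Tr₂ A^2)^{1/2})` is convex on positive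
semidefinite matrices indexed by `I × J`. -/
theorem Psi_two_convex {I J : Type*} [Fintype I] [Fintype J] [DecidableEq I] [DecidableEq J]
    (A B : Matrix (I × J) (I × J) ℂ) (hA : A.PosSemidef) (hB : B.PosSemidef)
    (t : ℝ) (ht0 : 0 ≤ t) (ht1 : t ≤ 1) :
    Psi 2 (t • A + (1 - t) • B) ≤ t * Psi 2 A + (1 - t) * Psi 2 B := by
  have ht : 0 ≤ 1 - t := sub_nonneg.2 ht1
  have hAB : (t • A + (1 - t) • B).IsHermitian :=
    ((hA.smul ht0).add (hB.smul ht)).isHermitian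
  rw [Psi_two_eq_matrixTraceNorm hAB, Psi_two_eq_matrixTraceNorm hA.isHermitian,
    Psi_two_eq_matrixTraceNorm hB.isHermitian]
  exact matrixTraceNorm_convex (rowReshape A) (rowReshape B) ht0 ht
end
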